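/- Let A be a poset and let G, H be games over A. Then G ≤ H (intrinsic order) if and only if [⊤] ≤ λ(Gᵒᵖ + H), and G ◁ H if and only if [⊤] ◁ λ(Gᵒᵖ + H), where [⊤] is the atomic game on the top element of 𝔹 and λ(Gᵒᵖ + H) is the comparison game, a game over 𝔹. -/

import Mathlib

/-- Games over a poset `α`: atomic games `[a]` for `a : α`, and composite games
`⟨L|R⟩` given by nonempty families of left and right options. -/
inductive Game (α : Type) : Type 1 where
  | atom : α → Game α
  | comp : (ι κ : Type) → (ι → Game α) → (κ → Game α) → Nonempty ι → Nonempty κ → Game α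

namespace Game

variable {α β : Type}

/-- `G'` is a left option of the game. -/
def IsLeftOption (G' : Game α) : Game α → Prop
  | atom _ => False
  | comp _ _ L _ _ _ => ∃ i, L i = G'

/-- `G'` is a right option of the game. -/
def IsRightOption (G' : Game α) : Game α → Prop
  | atom _ => False
  | comp _ _ _ R _ _ => ∃ k, R k = G'

/-- `G'` is an option of `G`. -/
def IsOption (G' G : Game α) : Prop := IsLeftOption G' G ∨ IsRightOption G' G

/-- A game is composite if it is not atomic. -/
def IsComposite : Game α → Prop
  | atom _ => False
  | comp _ _ _ _ _ _ => True

/-- `G'` is a follower of `G`: `G` itself, an option of `G`, or recursively a follower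
of an option of `G`. -/
def IsFollower (G' G : Game α) : Prop := Relation.ReflTransGen IsOption G' G

/-- The dual game: Left and Right switch sides; it is a game over the opposite poset. -/
def dual : Game α → Game αᵒᵈ
  | atom a => atom (OrderDual.toDual a)
  | comp ι κ L R hι hκ => comp κ ι (fun k => (R k).dual) (fun i => (L i).dual) hκ hι

/-- The image of a game under a (monotone) function applied to atoms. -/
def map (f : α → β) : Game α → Game β
  | atom a => atom (f a)
  | comp ι κ L R hι hκ => comp ι κ (fun i => (L i).map f) (fun k => (R k).map f) hι hκ

/-- The (disjunctive) sum of a game over `α` and a game over `β`, a game over `α × β`. -/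
noncomputable def add : Game α → Game β → Game (α × β) := by
  intro G
  induction G with
  | atom g =>
    intro H
    induction H with
    | atom h => exact atom (g, h)
    | comp ι κ L R hι hκ IHL IHR => exact comp ι κ IHL IHR hι hκ
  | comp ι κ L R hι hκ IHL IHR =>
    intro H
    induction H with
    | atom h => exact comp ι κ (fun i => IHL i (atom h)) (fun k => IHR k (atom h)) hι hκ
    | comp ι' κ' L' R' hι' hκ' IHL' IHR' =>
      exact comp (ι ⊕ ι') (κ ⊕ κ')
        (Sum.elim (fun i => IHL i (comp ι' κ' L' R' hι' hκ')) IHL')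
        (Sum.elim (fun k => IHR k (comp ι' κ' L' R' hι' hκ')) IHR')
        (hι.elim fun i => ⟨Sum.inl i⟩) (hκ.elim fun k => ⟨Sum.inl k⟩)

mutual
/-- Left has a first player winning strategy in a game over the boolean poset:
either the game is the atom `⊤`, or some left option has a second player
winning strategy for Left. -/
inductive LeftWinsFirst : Game Bool → Prop where
  | atom_top : LeftWinsFirst (atom true)
  | move {G G' : Game Bool} : IsLeftOption G' G → LeftWinsSecond G' → LeftWinsFirst G

/-- Left has a second player winning strategy in a game over the boolean poset:
every right option has a first player winning strategy for Left, and if the game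
is atomic it is the atom `⊤`. -/
inductive LeftWinsSecond : Game Bool → Prop where
  | mk {G : Game Bool} : (∀ G', IsRightOption G' G → LeftWinsFirst G') →
      (∀ b, G = atom b → b = true) → LeftWinsSecond G
end

mutual
/-- A game is even if all of its options are odd (atomic games are even). -/
inductive Even {α : Type} : Game α → Prop where
  | mk {G : Game α} : (∀ G', IsOption G' G → Odd G') → Even G

/-- A game is odd if it is composite and all of its options are even. -/
inductive Odd {α : Type} : Game α → Prop where
  | mk {G : Game α} : G.IsComposite → (∀ G', IsOption G' G → Even G') → Odd G
end

/-- A game has parity if it is even or odd. -/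
def HasParity (G : Game α) : Prop := Even G ∨ Odd G

/-- `G` and `H` have matching parity (both even or both odd). -/
def MatchingParity (G H : Game α) : Prop := (Even G ∧ Even H) ∨ (Odd G ∧ Odd H)

/-- `G` and `H` have mismatching parity (one even, the other odd). -/
def MismatchParity (G H : Game α) : Prop := (Even G ∧ Odd H) ∨ (Odd G ∧ Even H)

mutual
/-- The intrinsic order `G ≤ H` on games over a poset: every left option `G^L` of `G`
satisfies `G^L ◁ H`, every right option `H^R` of `H` satisfies `G ◁ H^R`, and if
both games are atoms `[g]`, `[h]` then `g ≤ h`. -/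
inductive Le {α : Type} [PartialOrder α] : Game α → Game α → Prop where
  | mk {G H : Game α} :
      (∀ G', IsLeftOption G' G → Tri G' H) →
      (∀ H', IsRightOption H' H → Tri G H') →
      (∀ g h, G = atom g → H = atom h → g ≤ h) →
      Le G H

/-- The intrinsic relation `G ◁ H` on games over a poset: some right option `G^R` of `G`
satisfies `G^R ≤ H`, or some left option `H^L` of `H` satisfies `G ≤ H^L`. -/
inductive Tri {α : Type} [PartialOrder α] : Game α → Game α → Prop where
  | inr {G H G' : Game α} : IsRightOption G' G → Le G' H → Tri G H
  | inl {G H H' : Game α} : IsLeftOption H' H → Le G H' → Tri G H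
end

/-- The comparison game `λ(Gᵒᵖ + H)`, a game over the boolean poset, where
`λ : αᵒᵈ × α → 𝔹` is the monotone map with `λ(xᵒᵖ, y) = ⊤` iff `x ≤ y`. -/
noncomputable def comparison [PartialOrder α] (G H : Game α) : Game Bool :=
  map (fun p : αᵒᵈ × α => @decide (OrderDual.ofDual p.1 ≤ p.2) (Classical.propDecidable _))
    (G.dual.add H)

/-- A game is locally premotive if Left has a first player winning strategy in
the comparison game `λ(Gᵒᵖ + G)`. -/
def LocallyPremotive [PartialOrder α] (G : Game α) : Prop := LeftWinsFirst (comparison G G)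

/-- A game is premotive if it and all of its followers are locally premotive. -/
def Premotive [PartialOrder α] (G : Game α) : Prop :=
  ∀ G', IsFollower G' G → LocallyPremotive G'

/-- The game `* = ⟨0|0⟩` over the one-element poset. -/
def star : Game Unit := comp Unit Unit (fun _ => atom ()) (fun _ => atom ()) ⟨()⟩ ⟨()⟩

/-- `G + *`, identified with a game over `α` via the isomorphism `α × 1 ≅ α`. -/
noncomputable def addStar (G : Game α) : Game α := map Prod.fst (G.add star)

/-- A game is locally `*`-antimonotone if `G^L + * ≤ G ≤ G^R + *` for all left and
right options `G^L`, `G^R`. -/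
def LocallyStarAnti [PartialOrder α] (G : Game α) : Prop :=
  (∀ G', IsLeftOption G' G → Le G'.addStar G) ∧ (∀ G', IsRightOption G' G → Le G G'.addStar)

/-- A game is `*`-antimonotone if it and all of its followers are locally
`*`-antimonotone. -/
def StarAnti [PartialOrder α] (G : Game α) : Prop :=
  ∀ G', IsFollower G' G → LocallyStarAnti G'

/-- `ε(G + X)`: the game `G` over `α` embedded in a context `X`, a game over the poset
`[α, 𝔹]` of monotone functions `α → 𝔹`, via the application map `ε(a, f) = f a`. -/
noncomputable def ctxSum [PartialOrder α] (G : Game α) (X : Game (α →o Bool)) : Game Bool :=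
  map (fun p : α × (α →o Bool) => p.2 p.1) (G.add X)

/-- The outcome `(o_L(G), o_R(G)) ∈ 𝔹 × 𝔹` of a game over the boolean poset:
`o_L(G) = ⊤` iff Left has a first player winning strategy and `o_R(G) = ⊤` iff
Left has a second player winning strategy. -/
noncomputable def outcome (G : Game Bool) : Bool × Bool :=
  (@decide (LeftWinsFirst G) (Classical.propDecidable _),
   @decide (LeftWinsSecond G) (Classical.propDecidable _))

/-- The contextual order `G ≤_c H`: `o(G+X) ≤ o(H+X)` for every context `X`. -/
def ContextualLe [PartialOrder α] (G H : Game α) : Prop :=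
  ∀ X : Game (α →o Bool), outcome (ctxSum G X) ≤ outcome (ctxSum H X)

/-- The contextual relation `G ◁_c H`: `o_R(G+X) ≤ o_L(H+X)` for every context `X`. -/
def ContextualTri [PartialOrder α] (G H : Game α) : Prop :=
  ∀ X : Game (α →o Bool), (outcome (ctxSum G X)).2 ≤ (outcome (ctxSum H X)).1

/-- Two games are identical when they are equal as set-based games: both are the same
atom, or both are composite with identical sets of left options and identical sets of
right options (recursively). -/
def Identical : Game α → Game α → Prop
  | atom a, atom b => a = b
  | comp _ _ L R _ _, comp _ _ L' R' _ _ =>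
      ((∀ i, ∃ i', Identical (L i) (L' i')) ∧ (∀ i', ∃ i, Identical (L i) (L' i'))) ∧
      ((∀ k, ∃ k', Identical (R k) (R' k')) ∧ (∀ k', ∃ k, Identical (R k) (R' k')))
  | _, _ => False

theorem rightOption_comparison [PartialOrder α] (G H : Game α) (P : Game Bool → Prop) :
    (∀ X, IsRightOption X (comparison G H) → P X) ↔
      (∀ G', IsLeftOption G' G → P (comparison G' H)) ∧
      (∀ H', IsRightOption H' H → P (comparison G H')) := by
  cases G with
  | atom g =>
    cases H with
    | atom h =>
      exact ⟨fun _ => ⟨fun _ h => h.elim, fun _ h => h.elim⟩, fun _ _ h => h.elim⟩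
    | comp ι κ L R hι hκ =>
      constructor
      · intro h
        refine ⟨fun _ h => h.elim, ?_⟩
        rintro _ ⟨k, rfl⟩
        exact h _ ⟨k, rfl⟩
      · rintro ⟨-, h⟩ _ ⟨k, rfl⟩
        exact h _ ⟨k, rfl⟩
  | comp ι κ L R hι hκ =>
    cases H with
    | atom h =>
      constructor
      · intro h
        refine ⟨?_, fun _ h => h.elim⟩
        rintro _ ⟨k, rfl⟩
        exact h _ ⟨k, rfl⟩
      · rintro ⟨h, -⟩ _ ⟨k, rfl⟩
        exact h _ ⟨k, rfl⟩
    | comp ι' κ' L' R' hι' hκ' =>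
      constructor
      · intro h
        constructor
        · rintro _ ⟨k, rfl⟩
          exact h _ ⟨Sum.inl k, rfl⟩
        · rintro _ ⟨k, rfl⟩
          exact h _ ⟨Sum.inr k, rfl⟩
      · rintro ⟨h, h'⟩ _ ⟨k | k, rfl⟩
        · exact h _ ⟨k, rfl⟩
        · exact h' _ ⟨k, rfl⟩

theorem leftOption_comparison [PartialOrder α] (G H : Game α) (P : Game Bool → Prop) :
    (∀ X, IsLeftOption X (comparison G H) → P X) ↔
      (∀ G', IsRightOption G' G → P (comparison G' H)) ∧
      (∀ H', IsLeftOption H' H → P (comparison G H')) := by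
  cases G with
  | atom g =>
    cases H with
    | atom h =>
      exact ⟨fun _ => ⟨fun _ h => h.elim, fun _ h => h.elim⟩, fun _ _ h => h.elim⟩
    | comp ι κ L R hι hκ =>
      constructor
      · intro h
        refine ⟨fun _ h => h.elim, ?_⟩
        rintro _ ⟨k, rfl⟩
        exact h _ ⟨k, rfl⟩
      · rintro ⟨-, h⟩ _ ⟨k, rfl⟩
        exact h _ ⟨k, rfl⟩
  | comp ι κ L R hι hκ =>
    cases H with
    | atom h =>
      constructor
      · intro h
        refine ⟨?_, fun _ h => h.elim⟩
        rintro _ ⟨k, rfl⟩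
        exact h _ ⟨k, rfl⟩
      · rintro ⟨h, -⟩ _ ⟨k, rfl⟩
        exact h _ ⟨k, rfl⟩
    | comp ι' κ' L' R' hι' hκ' =>
      constructor
      · intro h
        constructor
        · rintro _ ⟨k, rfl⟩
          exact h _ ⟨Sum.inl k, rfl⟩
        · rintro _ ⟨k, rfl⟩
          exact h _ ⟨Sum.inr k, rfl⟩
      · rintro ⟨h, h'⟩ _ ⟨k | k, rfl⟩
        · exact h _ ⟨k, rfl⟩
        · exact h' _ ⟨k, rfl⟩

theorem atom_comparison [PartialOrder α] (G H : Game α) :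
    (∀ g h, G = atom g → H = atom h → g ≤ h) ↔
      (∀ a b, (atom true : Game Bool) = atom a → comparison G H = atom b → a ≤ b) := by
  cases G with
  | atom g =>
    cases H with
    | atom h =>
      have e : comparison (atom g) (atom h) =
        atom (@decide (g ≤ h) (Classical.propDecidable _)) := rfl
      rw [e]
      constructor
      · intro hh a b _ hb
        cases hb
        simp [hh g h rfl rfl, Bool.le_true]
      · intro hh a b ha hb
        cases ha
        cases hb
        have := hh _ _ rfl rfl
        by_contra hn
        simp only [hn, decide_false] at this
        exact absurd this (by decide)
    | comp ι κ L R hι hκ =>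
      refine ⟨fun _ a b _ h => ?_, fun _ a b _ h => ?_⟩
      · exact absurd h (fun h => Game.noConfusion rfl (heq_of_eq h))
      · cases h
  | comp ι κ L R hι hκ =>
    refine ⟨fun _ a b _ h => ?_, fun _ a b h _ => ?_⟩
    · cases H <;> exact absurd h (fun h => Game.noConfusion rfl (heq_of_eq h))
    · cases h

theorem le_iff' [PartialOrder α] (G H : Game α) : Le G H ↔
    (∀ G', IsLeftOption G' G → Tri G' H) ∧ (∀ H', IsRightOption H' H → Tri G H') ∧
      (∀ g h, G = atom g → H = atom h → g ≤ h) :=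
  ⟨fun h => by cases h with | mk a b c => exact ⟨a, b, c⟩, fun ⟨a, b, c⟩ => Le.mk a b c⟩

theorem not_tri_iff [PartialOrder α] (G H : Game α) : ¬ Tri G H ↔
    (∀ G', IsRightOption G' G → ¬ Le G' H) ∧ (∀ H', IsLeftOption H' H → ¬ Le G H') := by
  constructor
  · exact fun h => ⟨fun _ o l => h (Tri.inr o l), fun _ o l => h (Tri.inl o l)⟩
  · rintro ⟨a, b⟩ h
    cases h with
    | inr o l => exact a _ o l
    | inl o l => exact b _ o l

theorem le_tri_step [PartialOrder α] (G H : Game α)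
    (hG : ∀ G', IsOption G' G → (Le G' H ↔ Le (atom true) (comparison G' H)) ∧
      (Tri G' H ↔ Tri (atom true) (comparison G' H)))
    (hH : ∀ H', IsOption H' H → (Le G H' ↔ Le (atom true) (comparison G H')) ∧
      (Tri G H' ↔ Tri (atom true) (comparison G H'))) :
    (Le G H ↔ Le (atom true) (comparison G H)) ∧
    (Tri G H ↔ Tri (atom true) (comparison G H)) := by
  constructor
  · rw [le_iff', le_iff' (atom true), rightOption_comparison, ← atom_comparison]
    constructor
    · rintro ⟨a, b, c⟩
      exact ⟨fun _ h => h.elim, ⟨fun G' o => (hG G' (Or.inl o)).2.1 (a _ o),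
        fun H' o => (hH H' (Or.inr o)).2.1 (b _ o)⟩, c⟩
    · rintro ⟨-, ⟨a, b⟩, c⟩
      exact ⟨fun G' o => (hG G' (Or.inl o)).2.2 (a _ o),
        fun H' o => (hH H' (Or.inr o)).2.2 (b _ o), c⟩
  · rw [← not_iff_not, not_tri_iff, not_tri_iff (atom true), leftOption_comparison]
    constructor
    · rintro ⟨a, b⟩
      exact ⟨fun _ h => h.elim, fun G' o l => a _ o ((hG G' (Or.inr o)).1.2 l),
        fun H' o l => b _ o ((hH H' (Or.inl o)).1.2 l)⟩
    · rintro ⟨-, a, b⟩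
      exact ⟨fun G' o l => a _ o ((hG G' (Or.inr o)).1.1 l),
        fun H' o l => b _ o ((hH H' (Or.inl o)).1.1 l)⟩

theorem option_induction (P : Game α → Prop)
    (step : ∀ G, (∀ G', IsOption G' G → P G') → P G) (G : Game α) : P G := by
  induction G with
  | atom a => exact step _ (fun _ h => h.elim False.elim False.elim)
  | comp ι κ L R hι hκ ihL ihR =>
    apply step
    rintro _ (⟨i, rfl⟩ | ⟨k, rfl⟩)
    · exact ihL i
    · exact ihR k

/-- `G ≤ H` iff `[⊤] ≤ λ(Gᵒᵖ + H)`, and `G ◁ H` iff `[⊤] ◁ λ(Gᵒᵖ + H)`. -/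
theorem le_tri_iff_comparison {α : Type} [PartialOrder α] (G H : Game α) :
    (Le G H ↔ Le (atom true) (comparison G H)) ∧
    (Tri G H ↔ Tri (atom true) (comparison G H)) := by
  induction G using option_induction generalizing H with
  | step G ihG =>
    induction H using option_induction with
    | step H ihH => exact le_tri_step G H (fun G' o => ihG G' o H) ihH

end Game
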